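/- Cubic decay of the measures of the return-time partition elements: there exists a constant C > 0 such that for every n ≥ 1, μ (S_n) ≤ C / n ^ 3. -/

import Mathlib

open MeasureTheory
open scoped NNReal ENNReal

noncomputable section

instance : Fact ((0:ℝ) < 2) := ⟨by norm_num⟩

/-- The torus, as a product of two circles of circumference 2. -/
abbrev 𝕋 : Type := AddCircle (2:ℝ) × AddCircle (2:ℝ)

/-- The unique representative in `[0, 2)` of a point of the circle. -/
def θ (x : AddCircle (2:ℝ)) : ℝ := ((AddCircle.equivIco 2 0) x : ℝ)

def P : Set 𝕋 := {z | θ z.2 ≤ 1}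
def Q : Set 𝕋 := {z | θ z.1 ≤ 1}
def R : Set 𝕋 := P ∪ Q
def S : Set 𝕋 := P ∩ Q

/-- The horizontal twist map. -/
def F (z : 𝕋) : 𝕋 :=
  if θ z.2 ≤ 1 then (z.1 + (((2 * θ z.2 : ℝ) : AddCircle (2:ℝ))), z.2) else z

/-- The vertical twist map. -/
def G (z : 𝕋) : 𝕋 :=
  if θ z.1 ≤ 1 then (z.1, z.2 + (((2 * θ z.1 : ℝ) : AddCircle (2:ℝ)))) else z

/-- The linked-twist map. -/
def H : 𝕋 → 𝕋 := G ∘ F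

/-- The first-return time of `T` to `S`. -/
def rtn (T : 𝕋 → 𝕋) (z : 𝕋) : ℕ := sInf {n : ℕ | 1 ≤ n ∧ T^[n] z ∈ S}

/-- The first-return map of `T` to `S`. -/
def retMap (T : 𝕋 → 𝕋) (z : 𝕋) : 𝕋 := T^[rtn T z] z

/-- The set of points of `S` with return time exactly `n`. -/
def Sn (n : ℕ) : Set 𝕋 := {z | z ∈ S ∧ rtn H z = n}

/-! ### Representatives on the circle -/

lemma θ_nonneg (x : AddCircle (2:ℝ)) : 0 ≤ θ x := ((AddCircle.equivIco 2 0) x).2.1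

lemma θ_lt_two (x : AddCircle (2:ℝ)) : θ x < 2 := by
  have h : θ x < 0 + 2 := ((AddCircle.equivIco 2 0) x).2.2
  rwa [zero_add] at h

lemma coe_θ (x : AddCircle (2:ℝ)) : ((θ x : ℝ) : AddCircle (2:ℝ)) = x :=
  AddCircle.coe_equivIco

lemma θ_coe_of_mem {r : ℝ} (h0 : 0 ≤ r) (h2 : r < 2) : θ (r : AddCircle (2:ℝ)) = r := by
  have h : r ∈ Set.Ico (0:ℝ) (0 + 2) := ⟨h0, by linarith⟩
  rw [θ, AddCircle.equivIco_coe_eq h]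

lemma coe_add_two (r : ℝ) : ((r + 2 : ℝ) : AddCircle (2:ℝ)) = r :=
  AddCircle.coe_add_period 2 r

lemma θ_coe_of_mem_add_two {r : ℝ} (h0 : -2 ≤ r) (h2 : r < 0) :
    θ (r : AddCircle (2:ℝ)) = r + 2 := by
  rw [← coe_add_two, θ_coe_of_mem (by linarith) (by linarith)]

lemma θ_coe_of_mem_sub_two {r : ℝ} (h0 : 2 ≤ r) (h2 : r < 4) :
    θ (r : AddCircle (2:ℝ)) = r - 2 := by
  have h := coe_add_two (r - 2)
  rw [sub_add_cancel] at h
  rw [h, θ_coe_of_mem (by linarith) (by linarith)]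

lemma measurable_θ : Measurable θ :=
  measurable_subtype_coe.comp (AddCircle.measurableEquivIco 2 0).measurable

lemma measurePreserving_θ :
    MeasurePreserving θ volume (volume.restrict (Set.Ico (0:ℝ) 2)) := by
  refine ⟨measurable_θ, ?_⟩
  have h := (AddCircle.measurePreserving_mk 2 0).map_eq
  rw [zero_add, ← restrict_Ico_eq_restrict_Ioc] at h
  rw [← h, Measure.map_map measurable_θ AddCircle.measurable_mk']
  have hid : (θ ∘ fun r : ℝ => (r : AddCircle (2:ℝ)))
      =ᵐ[volume.restrict (Set.Ico (0:ℝ) 2)] id := by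
    filter_upwards [ae_restrict_mem measurableSet_Ico] with r hr
    exact θ_coe_of_mem hr.1 hr.2
  exact (Measure.map_congr hid).trans Measure.map_id

lemma volume_θ_preimage_le {E : Set (ℝ × ℝ)} (hE : MeasurableSet E) :
    volume {z : 𝕋 | (θ z.1, θ z.2) ∈ E} ≤ volume E := by
  have h := (measurePreserving_θ.prod measurePreserving_θ).measure_preimage hE.nullMeasurableSet
  refine (le_of_eq h).trans ?_
  rw [Measure.prod_restrict]
  exact Measure.restrict_apply_le _ _

/-! ### The twist maps -/

lemma measurePreserving_F : MeasurePreserving F (volume : Measure 𝕋) volume := by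
  let c : AddCircle (2:ℝ) → AddCircle (2:ℝ) :=
    fun y => if θ y ≤ 1 then ((2 * θ y : ℝ) : AddCircle (2:ℝ)) else 0
  have hc : Measurable c := by
    refine Measurable.ite (measurableSet_le measurable_θ measurable_const) ?_ measurable_const
    exact AddCircle.measurable_mk'.comp (measurable_θ.const_mul 2)
  have hskew : MeasurePreserving
      (fun p : AddCircle (2:ℝ) × AddCircle (2:ℝ) => (p.1, p.2 + c p.1))
      (volume.prod volume) (volume.prod volume) :=
    (MeasurePreserving.id volume).skew_product
      (g := fun y x => x + c y) (measurable_snd.add (hc.comp measurable_fst))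
      (Filter.Eventually.of_forall fun y => (measurePreserving_add_right volume (c y)).map_eq)
  have h := (Measure.measurePreserving_swap.comp hskew).comp
    (Measure.measurePreserving_swap (μ := (volume : Measure (AddCircle (2:ℝ))))
      (ν := (volume : Measure (AddCircle (2:ℝ)))))
  have hF : F = (Prod.swap ∘ fun p : AddCircle (2:ℝ) × AddCircle (2:ℝ) => (p.1, p.2 + c p.1))
      ∘ Prod.swap := by
    funext z
    by_cases hz : θ z.2 ≤ 1 <;> simp [F, c, hz]
  rw [hF]
  exact h

lemma G_eq_swap (z : 𝕋) : G z = (F z.swap).swap := by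
  by_cases hz : θ z.1 ≤ 1 <;> simp [F, G, hz]

lemma G_iterate_eq_swap (n : ℕ) (z : 𝕋) : G^[n] z = (F^[n] z.swap).swap := by
  induction n generalizing z with
  | zero => simp
  | succ n ih => rw [Function.iterate_succ_apply, Function.iterate_succ_apply, ih, G_eq_swap,
      Prod.swap_swap]

lemma F_iterate_snd (n : ℕ) (z : 𝕋) : (F^[n] z).2 = z.2 := by
  induction n with
  | zero => rfl
  | succ n ih =>
    rw [Function.iterate_succ_apply', F]
    split_ifs <;> simpa using ih

lemma F_iterate_fst {z : 𝕋} (hz : z ∈ P) (n : ℕ) :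
    (F^[n] z).1 = ((θ z.1 + 2 * n * θ z.2 : ℝ) : AddCircle (2:ℝ)) := by
  have hz' : θ z.2 ≤ 1 := hz
  induction n with
  | zero => simp [coe_θ]
  | succ n ih =>
    have h2 := F_iterate_snd n z
    rw [Function.iterate_succ_apply', F, h2, if_pos hz', ih]
    change ((_ : ℝ) : AddCircle (2:ℝ)) + _ = _
    rw [← AddCircle.coe_add]
    refine congrArg (fun r : ℝ => (r : AddCircle (2:ℝ))) ?_
    push_cast
    ring

lemma G_iterate_fst (n : ℕ) (z : 𝕋) : (G^[n] z).1 = z.1 := by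
  rw [G_iterate_eq_swap]
  exact F_iterate_snd n z.swap

/-! ### First hitting sets for the horizontal twist -/

/-- The points of `S` whose first visit to `Q` under `F`, at a positive time, is at time `n`. -/
def firstHit (n : ℕ) : Set 𝕋 :=
  {z | z ∈ S ∧ (∀ i, 1 ≤ i → i < n → F^[i] z ∉ Q) ∧ F^[n] z ∈ Q}

/-- The strip of points moving to the right that cross `(1, 2)` in exactly `n` steps. -/
structure Crossing (n : ℕ) (x y : ℝ) : Prop where
  le_one : x ≤ 1
  one_lt : 1 < x + 2 * y
  lt_two : x + 2 * (n - 1) * y < 2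
  two_le : 2 ≤ x + 2 * n * y

lemma crossing_of_firstHit {n : ℕ} (hn : 2 ≤ n) {z : 𝕋} (hz : z ∈ firstHit n) :
    (Crossing n (θ z.1) (θ z.2) ∧ θ (F^[n] z).1 = θ z.1 + 2 * n * θ z.2 - 2) ∨
    (Crossing n (1 - θ z.1) (1 - θ z.2) ∧
      θ (F^[n] z).1 = θ z.1 - 2 * n * (1 - θ z.2) + 2) := by
  obtain ⟨⟨hP, hQ⟩, hout, hin⟩ := hz
  have hx0 := θ_nonneg z.1
  have hx1 : θ z.1 ≤ 1 := hQ
  have hy0 := θ_nonneg z.2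
  have hy1 : θ z.2 ≤ 1 := hP
  have hfst := F_iterate_fst hP
  have hshift : ∀ i : ℕ, (F^[i] z).1
      = ((θ z.1 - 2 * i * (1 - θ z.2) : ℝ) : AddCircle (2:ℝ)) := by
    intro i
    induction i with
    | zero => simp [coe_θ]
    | succ i ih =>
      rw [hfst] at ih ⊢
      rw [← coe_add_two (_ - _)]
      have h1 : θ z.1 + 2 * ((i + 1 : ℕ) : ℝ) * θ z.2
        = (θ z.1 + 2 * (i : ℝ) * θ z.2) + 2 * θ z.2 := by push_cast; ring
      have h2 : θ z.1 - 2 * ((i + 1 : ℕ) : ℝ) * (1 - θ z.2) + 2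
        = (θ z.1 - 2 * (i : ℝ) * (1 - θ z.2)) + 2 * θ z.2 := by push_cast; ring
      rw [h1, h2, AddCircle.coe_add (2:ℝ) (_ + _), ih, ← AddCircle.coe_add]
  have hout' : ∀ i, 1 ≤ i → i < n → 1 < θ (F^[i] z).1 :=
    fun i h1 h2 => not_le.mp (hout i h1 h2)
  have hin' : θ (F^[n] z).1 ≤ 1 := hin
  have hcast : ((n - 1 : ℕ) : ℝ) = n - 1 := by
    rw [Nat.cast_sub (by omega)]; simp
  rcases le_total (θ z.2) (1/2) with hy | hy
  · left
    have key : ∀ i : ℕ, 1 ≤ i → i < n →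
        1 < θ z.1 + 2 * i * θ z.2 ∧ θ z.1 + 2 * i * θ z.2 < 2 := by
      intro i hi
      induction i, hi using Nat.le_induction with
      | base =>
        intro h
        have h1 := hout' 1 le_rfl h
        rw [hfst] at h1
        push_cast at h1 ⊢
        rcases lt_or_ge (θ z.1 + 2 * 1 * θ z.2) 2 with h2 | h2
        · rw [θ_coe_of_mem (by linarith) h2] at h1
          exact ⟨h1, h2⟩
        · rw [θ_coe_of_mem_sub_two h2 (by linarith)] at h1
          linarith
      | succ i hi ih =>
        intro h
        have h1 := hout' (i + 1) (by omega) h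
        obtain ⟨ih1, ih2⟩ := ih (by omega)
        rw [hfst] at h1
        push_cast at h1 ⊢
        rcases lt_or_ge (θ z.1 + 2 * (i + 1) * θ z.2) 2 with h2 | h2
        · rw [θ_coe_of_mem (by linarith) h2] at h1
          exact ⟨h1, h2⟩
        · rw [θ_coe_of_mem_sub_two h2 (by linarith)] at h1
          linarith
    obtain ⟨a1, -⟩ := key 1 le_rfl (by omega)
    obtain ⟨b1, b2⟩ := key (n - 1) (by omega) (by omega)
    rw [hcast] at b1 b2
    have h2 : 2 ≤ θ z.1 + 2 * n * θ z.2 := by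
      by_contra! h2
      rw [hfst, θ_coe_of_mem (by linarith) h2] at hin'
      linarith
    refine ⟨⟨hx1, by push_cast at a1; linarith, b2, h2⟩, ?_⟩
    rw [hfst, θ_coe_of_mem_sub_two h2 (by linarith)]
  · right
    have key : ∀ i : ℕ, 1 ≤ i → i < n →
        -1 < θ z.1 - 2 * i * (1 - θ z.2) ∧ θ z.1 - 2 * i * (1 - θ z.2) < 0 := by
      intro i hi
      induction i, hi using Nat.le_induction with
      | base =>
        intro h
        have h1 := hout' 1 le_rfl h
        rw [hshift] at h1
        push_cast at h1 ⊢
        rcases lt_or_ge (θ z.1 - 2 * 1 * (1 - θ z.2)) 0 with h2 | h2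
        · rw [θ_coe_of_mem_add_two (by linarith) h2] at h1
          exact ⟨by linarith, h2⟩
        · rw [θ_coe_of_mem h2 (by linarith)] at h1
          linarith
      | succ i hi ih =>
        intro h
        have h1 := hout' (i + 1) (by omega) h
        obtain ⟨ih1, ih2⟩ := ih (by omega)
        rw [hshift] at h1
        push_cast at h1 ⊢
        rw [θ_coe_of_mem_add_two (by linarith) (by linarith)] at h1
        exact ⟨by linarith, by linarith⟩
    obtain ⟨a1, a2⟩ := key 1 le_rfl (by omega)
    obtain ⟨b1, b2⟩ := key (n - 1) (by omega) (by omega)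
    rw [hcast] at b1 b2
    have hθ : θ (F^[n] z).1 = θ z.1 - 2 * n * (1 - θ z.2) + 2 := by
      rw [hshift, θ_coe_of_mem_add_two (by linarith) (by linarith)]
    refine ⟨⟨by linarith, by push_cast at a2; linarith, by linarith, by linarith⟩, hθ⟩

/-- A point entering `Q` after at least five horizontal steps is sent into `P` by one
vertical step. -/
lemma G_mem_P_of_firstHit {n : ℕ} (hn : 5 ≤ n) {z : 𝕋} (hz : z ∈ firstHit n) :
    G (F^[n] z) ∈ P := by
  have hnR : (5:ℝ) ≤ n := by exact_mod_cast hn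
  have hQ : θ (F^[n] z).1 ≤ 1 := hz.2.2
  have hy0 := θ_nonneg z.2
  have hy1 : θ z.2 ≤ 1 := hz.1.1
  have hG : (G (F^[n] z)).2 = ((θ z.2 + 2 * θ (F^[n] z).1 : ℝ) : AddCircle (2:ℝ)) := by
    rw [G, if_pos hQ, AddCircle.coe_add, coe_θ]
    exact congrArg (· + _) (F_iterate_snd n z)
  change θ (G (F^[n] z)).2 ≤ 1
  rw [hG]
  rcases crossing_of_firstHit (by omega) hz with ⟨⟨h1, h2, h3, h4⟩, hv⟩ | ⟨⟨h1, h2, h3, h4⟩, hv⟩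
  · have hsmall : 3 * (2 * θ z.2) < 1 := by nlinarith
    rw [hv, θ_coe_of_mem (by linarith) (by linarith)]
    linarith
  · have hsmall : 3 * (2 * (1 - θ z.2)) < 1 := by nlinarith
    rw [θ_coe_of_mem_sub_two (by linarith) (by linarith)]
    linarith

/-! ### Measure estimates -/

/-- A thin strip around the graph of `x ↦ (2 - x) / (2 n)`. -/
def strip (n : ℕ) (a : ℝ) : Set (ℝ × ℝ) :=
  {p | 1 - a < p.1 ∧ p.1 ≤ 1 ∧ (2 - p.1) / (2 * n) ≤ p.2 ∧ p.2 ≤ (2 - p.1) / (2 * n) + a ^ 2}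

lemma measurableSet_strip (n : ℕ) (a : ℝ) : MeasurableSet (strip n a) := by
  unfold strip
  measurability

lemma volume_strip_le (n : ℕ) (a : ℝ) :
    volume (strip n a) ≤ ENNReal.ofReal (a ^ 3) := by
  rw [Measure.volume_eq_prod, Measure.prod_apply (measurableSet_strip n a)]
  calc ∫⁻ x, volume (Prod.mk x ⁻¹' strip n a)
      ≤ ∫⁻ x, (Set.Ioc (1 - a) 1).indicator (fun _ => ENNReal.ofReal (a ^ 2)) x := by
        refine lintegral_mono fun x => ?_
        by_cases hx : x ∈ Set.Ioc (1 - a) 1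
        · rw [Set.indicator_of_mem hx]
          refine (measure_mono (t := Set.Icc ((2 - x) / (2 * n)) ((2 - x) / (2 * n) + a ^ 2))
            fun y hy => ⟨hy.2.2.1, hy.2.2.2⟩).trans ?_
          rw [Real.volume_Icc, add_sub_cancel_left]
        · rw [Set.indicator_of_notMem hx, nonpos_iff_eq_zero]
          have : Prod.mk x ⁻¹' strip n a = ∅ :=
            Set.eq_empty_of_forall_notMem fun y hy => hx ⟨hy.1, hy.2.1⟩
          rw [this, measure_empty]
    _ = ENNReal.ofReal (a ^ 3) := by
        rw [lintegral_indicator measurableSet_Ioc, setLIntegral_const, Real.volume_Ioc,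
          ← ENNReal.ofReal_mul (by positivity)]
        congr 1
        ring

lemma Crossing.mem_strip {n : ℕ} (hn : 3 ≤ n) {x y : ℝ} (h : Crossing n x y) :
    (x, y) ∈ strip n (1 / (n - 2)) := by
  obtain ⟨h1, h2, h3, h4⟩ := h
  have hnR : (3:ℝ) ≤ n := by exact_mod_cast hn
  have hm : (0:ℝ) < n - 2 := by linarith
  have hm1 : (0:ℝ) < n - 1 := by linarith
  have hy : 2 * y < 1 / (n - 2) := by
    rw [lt_div_iff₀ hm]
    linarith
  have ha : 1 / ((n:ℝ) - 2) ≤ 1 := by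
    rw [div_le_one hm]
    linarith
  have hx : 0 < x := by linarith
  refine ⟨by linarith, h1, ?_, ?_⟩
  · rw [div_le_iff₀ (by linarith)]
    linarith
  · have hub : y ≤ (2 - x) / (2 * (n - 1)) := by
      rw [le_div_iff₀ (by linarith)]
      linarith
    have heq : (2 - x) / (2 * (n - 1)) = (2 - x) / (2 * n) + (2 - x) / 2 * (1 / (n * (n - 1))) := by
      field_simp
      ring
    have hsq : 1 / ((n:ℝ) * (n - 1)) ≤ (1 / (n - 2)) ^ 2 := by
      rw [one_div_pow]
      refine one_div_le_one_div_of_le (by positivity) ?_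
      nlinarith
    have hpos : 0 < 1 / ((n:ℝ) * (n - 1)) := by positivity
    change y ≤ _
    nlinarith

/-- The union of the strip and of its image under the central symmetry of the unit square. -/
def doubleStrip (n : ℕ) : Set (ℝ × ℝ) :=
  strip n (1 / (n - 2)) ∪ (fun p : ℝ × ℝ => (1 - p.1, 1 - p.2)) ⁻¹' strip n (1 / (n - 2))

lemma measurableSet_doubleStrip (n : ℕ) : MeasurableSet (doubleStrip n) := by
  refine (measurableSet_strip _ _).union ((measurableSet_strip _ _).preimage ?_)
  fun_prop

lemma volume_doubleStrip_le (n : ℕ) :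
    volume (doubleStrip n) ≤ ENNReal.ofReal (2 * (1 / (n - 2)) ^ 3) := by
  have hrefl : MeasurePreserving (fun p : ℝ × ℝ => (1 - p.1, 1 - p.2)) volume volume :=
    (Measure.measurePreserving_sub_left volume (1:ℝ)).prod (Measure.measurePreserving_sub_left volume (1:ℝ))
  refine (measure_union_le _ _).trans ?_
  rw [hrefl.measure_preimage (measurableSet_strip _ _).nullMeasurableSet, ← two_mul,
    ENNReal.ofReal_mul zero_le_two, ENNReal.ofReal_ofNat]
  gcongr
  exact volume_strip_le n _

/-- A measurable set containing `firstHit n`. -/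
def firstHitHull (n : ℕ) : Set 𝕋 := {z | (θ z.1, θ z.2) ∈ doubleStrip n}

lemma measurableSet_firstHitHull (n : ℕ) : MeasurableSet (firstHitHull n) :=
  measurableSet_preimage
    ((measurable_θ.comp measurable_fst).prodMk (measurable_θ.comp measurable_snd))
    (measurableSet_doubleStrip n)

lemma firstHit_subset_hull {n : ℕ} (hn : 3 ≤ n) : firstHit n ⊆ firstHitHull n := by
  intro z hz
  rcases crossing_of_firstHit (by omega) hz with h | h
  · exact Or.inl (h.1.mem_strip hn)
  · exact Or.inr (h.1.mem_strip hn)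

lemma volume_firstHitHull_le (n : ℕ) :
    volume (firstHitHull n) ≤ ENNReal.ofReal (2 * (1 / (n - 2)) ^ 3) :=
  (volume_θ_preimage_le (measurableSet_doubleStrip n)).trans (volume_doubleStrip_le n)

/-! ### Decomposition of the return-time sets -/

lemma H_iterate_of_forall_notMem {z : 𝕋} {n : ℕ} (h : ∀ i, 1 ≤ i → i < n → F^[i] z ∉ Q)
    {i : ℕ} (hi : i < n) : H^[i] z = F^[i] z := by
  induction i with
  | zero => rfl
  | succ i ih =>
    have hG : ¬ θ (F (F^[i] z)).1 ≤ 1 := by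
      rw [← Function.iterate_succ_apply' F]
      exact h (i + 1) (by omega) hi
    rw [Function.iterate_succ_apply', Function.iterate_succ_apply', ih (by omega), H,
      Function.comp_apply, G, if_neg hG]

lemma H_iterate_eq_G_of_forall_notMem {z : 𝕋} {n : ℕ} (hn : 1 ≤ n)
    (h : ∀ i, 1 ≤ i → i < n → F^[i] z ∉ Q) : H^[n] z = G (F^[n] z) := by
  obtain ⟨m, rfl⟩ : ∃ m, n = m + 1 := ⟨n - 1, by omega⟩
  rw [Function.iterate_succ_apply', Function.iterate_succ_apply',
    H_iterate_of_forall_notMem h (Nat.lt_succ_self m)]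
  rfl

lemma firstHit_or_of_mem_Sn {n : ℕ} (hn : 1 ≤ n) {z : 𝕋} (hz : z ∈ Sn n) :
    z ∈ firstHit n ∨
      ∃ k, 1 ≤ k ∧ k ≤ 4 ∧ k < n ∧ (F^[k] z).swap ∈ firstHit (n - k + 1) := by
  obtain ⟨hzS, hr⟩ := hz
  have hne : {m : ℕ | 1 ≤ m ∧ H^[m] z ∈ S}.Nonempty := by
    by_contra hne
    rw [Set.not_nonempty_iff_eq_empty] at hne
    rw [rtn, hne, Nat.sInf_empty] at hr
    omega
  have hmem : H^[n] z ∈ S := by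
    have h := (Nat.sInf_mem hne).2
    rwa [← hr]
  have hmin : ∀ i, 1 ≤ i → i < n → H^[i] z ∉ S := by
    intro i h1 h2 h3
    rw [← hr] at h2
    exact Nat.notMem_of_lt_sInf h2 ⟨h1, h3⟩
  by_cases hall : ∀ i, 1 ≤ i → i < n → F^[i] z ∉ Q
  · left
    refine ⟨hzS, hall, ?_⟩
    rw [H_iterate_eq_G_of_forall_notMem hn hall] at hmem
    have h : θ (G (F^[n] z)).1 ≤ 1 := hmem.2
    have h1 : (G (F^[n] z)).1 = (F^[n] z).1 := G_iterate_fst 1 _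
    rw [h1] at h
    exact h
  · right
    push Not at hall
    classical
    obtain ⟨hk1, hkn, hkQ⟩ := Nat.find_spec hall
    set k := Nat.find hall with hk
    have hkmin : ∀ i, 1 ≤ i → i < k → F^[i] z ∉ Q := fun i h1 h2 h3 =>
      Nat.find_min hall h2 ⟨h1, h2.trans hkn, h3⟩
    set w := F^[k] z with hw
    have hwP : w ∈ P := by
      change θ (F^[k] z).2 ≤ 1
      rw [F_iterate_snd]
      exact hzS.1
    have hGQ : ∀ i, G^[i] w ∈ Q := by
      intro i
      change θ (G^[i] w).1 ≤ 1
      rw [G_iterate_fst]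
      exact hkQ
    have hH : ∀ j, k + j ≤ n → H^[k + j] z = G^[j + 1] w := by
      intro j
      induction j with
      | zero => exact fun _ => H_iterate_eq_G_of_forall_notMem hk1 hkmin
      | succ j ih =>
        intro hj
        have hnS := hmin (k + j) (by omega) (by omega)
        rw [ih (by omega)] at hnS
        have hnP : ¬ θ (G^[j + 1] w).2 ≤ 1 := fun h => hnS ⟨h, hGQ _⟩
        rw [← add_assoc, Function.iterate_succ_apply', ih (by omega), H, Function.comp_apply, F,
          if_neg hnP, Function.iterate_succ_apply' G (j + 1)]
    have hGP : ∀ i, 1 ≤ i → i < n - k + 1 → G^[i] w ∉ P := by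
      intro i h1 h2 h3
      obtain ⟨j, rfl⟩ : ∃ j, i = j + 1 := ⟨i - 1, by omega⟩
      have hnS := hmin (k + j) (by omega) (by omega)
      rw [hH j (by omega)] at hnS
      exact hnS ⟨h3, hGQ _⟩
    refine ⟨k, hk1, ?_, hkn, ⟨hkQ, hwP⟩, ?_, ?_⟩
    · by_contra! h5
      exact hGP 1 le_rfl (by omega) (G_mem_P_of_firstHit h5 ⟨hzS, hkmin, hkQ⟩)
    · intro i h1 h2 h3
      refine hGP i h1 h2 ?_
      rw [G_iterate_eq_swap]
      exact h3
    · have h := hH (n - k) (by omega)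
      rw [Nat.add_sub_cancel' hkn.le] at h
      rw [h, G_iterate_eq_swap] at hmem
      exact hmem.1

lemma volume_preimage_swap_firstHitHull (k m : ℕ) :
    volume {z : 𝕋 | (F^[k] z).swap ∈ firstHitHull m} = volume (firstHitHull m) := by
  have hswap : MeasurePreserving (Prod.swap : 𝕋 → 𝕋) volume volume :=
    Measure.measurePreserving_swap
  exact (hswap.comp (measurePreserving_F.iterate k)).measure_preimage
    (measurableSet_firstHitHull m).nullMeasurableSet

lemma volume_Sn_le {n : ℕ} (hn : 10 ≤ n) :
    (volume : Measure 𝕋) (Sn n) ≤ ENNReal.ofReal (80 / (n : ℝ) ^ 3) := by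
  have hnR : (10:ℝ) ≤ n := by exact_mod_cast hn
  have hbound : ∀ m : ℕ, n ≤ m + 3 →
      volume (firstHitHull m) ≤ ENNReal.ofReal (16 / (n : ℝ) ^ 3) := by
    intro m hm
    have hmR : (n:ℝ) ≤ m + 3 := by exact_mod_cast hm
    refine (volume_firstHitHull_le m).trans (ENNReal.ofReal_le_ofReal ?_)
    have h1 : 1 / ((m:ℝ) - 2) ≤ 2 / n := by
      rw [div_le_div_iff₀ (by linarith) (by linarith)]
      linarith
    have h0 : 0 ≤ 1 / ((m:ℝ) - 2) := one_div_nonneg.mpr (by linarith)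
    calc 2 * (1 / ((m:ℝ) - 2)) ^ 3 ≤ 2 * (2 / n) ^ 3 := by gcongr
      _ = 16 / (n : ℝ) ^ 3 := by ring
  have hsub : Sn n ⊆ firstHitHull n ∪
      ⋃ k ∈ Finset.Icc 1 4, {z : 𝕋 | (F^[k] z).swap ∈ firstHitHull (n - k + 1)} := by
    intro z hz
    rcases firstHit_or_of_mem_Sn (by omega) hz with h | ⟨k, h1, h4, hkn, h⟩
    · exact Or.inl (firstHit_subset_hull (by omega) h)
    · refine Or.inr (Set.mem_biUnion (x := k) (by simp [h1, h4]) ?_)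
      exact firstHit_subset_hull (by omega) h
  calc volume (Sn n)
      ≤ volume (firstHitHull n) + ∑ k ∈ Finset.Icc 1 4,
          volume {z : 𝕋 | (F^[k] z).swap ∈ firstHitHull (n - k + 1)} :=
        (measure_mono hsub).trans ((measure_union_le _ _).trans
          (add_le_add_right (measure_biUnion_finset_le _ _) _))
    _ ≤ ENNReal.ofReal (16 / (n : ℝ) ^ 3)
          + ∑ _k ∈ Finset.Icc 1 4, ENNReal.ofReal (16 / (n : ℝ) ^ 3) := by
        refine add_le_add (hbound n (by omega)) (Finset.sum_le_sum fun k hk => ?_)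
        rw [Finset.mem_Icc] at hk
        rw [volume_preimage_swap_firstHitHull]
        exact hbound _ (by omega)
    _ = ENNReal.ofReal (80 / (n : ℝ) ^ 3) := by
        have h0 : (0:ℝ) ≤ 16 / (n : ℝ) ^ 3 := by positivity
        rw [← ENNReal.ofReal_sum_of_nonneg fun _ _ => h0, Finset.sum_const,
          ← ENNReal.ofReal_add h0 (by positivity)]
        congr 1
        norm_num
        ring

lemma volume_torus : (volume : Measure 𝕋) Set.univ = ENNReal.ofReal 4 := by
  rw [Measure.volume_eq_prod, ← Set.univ_prod_univ, Measure.prod_prod, AddCircle.measure_univ,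
    ← ENNReal.ofReal_mul zero_le_two]
  norm_num

/-- Cubic decay of the measures of the return-time partition elements. -/
theorem measure_Sn_cubic_decay :
    ∃ C : ℝ, 0 < C ∧ ∀ n : ℕ, 1 ≤ n →
      (volume : Measure 𝕋) (Sn n) ≤ ENNReal.ofReal (C / (n : ℝ) ^ 3) := by
  refine ⟨4000, by norm_num, fun n hn => ?_⟩
  have hnR : (1:ℝ) ≤ n := by exact_mod_cast hn
  rcases le_or_gt 10 n with h | h
  · refine (volume_Sn_le h).trans (ENNReal.ofReal_le_ofReal ?_)
    gcongr
    norm_num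
  · refine (measure_mono (Set.subset_univ _)).trans ?_
    rw [volume_torus]
    refine ENNReal.ofReal_le_ofReal ?_
    rw [le_div_iff₀ (by positivity)]
    have h10 : (n:ℝ) ≤ 10 := by exact_mod_cast h.le
    calc (4:ℝ) * n ^ 3 ≤ 4 * 10 ^ 3 := by gcongr
      _ = 4000 := by norm_num
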